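/- Let m, T ≥ 1, s > 0, c ≥ 0, ε ≥ 0, L ≥ 0, and let p be the m-fold product of Gaussian measures N(0, s²) on ℝ^m. Let φ_1, …, φ_T ∈ ℝ^m with ‖φ_t‖ ≤ 1, and let k̄ : {1,…,T}×{1,…,T} → ℝ satisfy |⟨φ_t, φ_{t'}⟩ − k̄(t,t')| ≤ ε and |k̄(t,t')| ≤ 1 for all t, t'. For each t let L_t : ℝ → ℝ be nonnegative, L-Lipschitz, and twice differentiable with |L_t''(z)| ≤ c for all z. Let α : {1,…,T} → ℝ, set C = s²·Σ_{t'} |α_{t'}|, θ* = s²·Σ_{t'} α_{t'}·φ_{t'}, and f̂*_t = s²·Σ_{t'} α_{t'}·k̄(t,t'). Then −log ∫_{ℝ^m} exp(−Σ_{t=1}^T L_t(⟨φ_t, θ⟩)) dp(θ) ≤ Σ_{t=1}^T L_t(f̂*_t) + (1+ε)·C²/(2s²) + (m/2)·log(1 + T·c·s²/m) + ε·L·T·C. -/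

import Mathlib

open MeasureTheory ProbabilityTheory
open scoped BigOperators RealInnerProductSpace

namespace MeasureTheory

theorem Measure.pi_withDensity {ι : Type*} [Fintype ι] {X : ι → Type*}
    [∀ i, MeasurableSpace (X i)] (μ : ∀ i, Measure (X i)) [∀ i, IsProbabilityMeasure (μ i)]
    {f : ∀ i, X i → ENNReal} (hf : ∀ i, Measurable (f i))
    [∀ i, SigmaFinite ((μ i).withDensity (f i))] :
    Measure.pi (fun i => (μ i).withDensity (f i)) =
      (Measure.pi μ).withDensity (fun x => ∏ i, f i (x i)) := by
  refine Measure.pi_eq fun s hs => ?_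
  rw [withDensity_apply _ (MeasurableSet.univ_pi hs), ← lintegral_indicator (.univ_pi hs)]
  have hind : (Set.univ.pi s).indicator (fun x => ∏ i, f i (x i)) =
      fun x => ∏ i, (s i).indicator (f i) (x i) := by
    ext x
    by_cases hx : x ∈ Set.univ.pi s
    · rw [Set.indicator_of_mem hx]
      exact Finset.prod_congr rfl fun i _ => (Set.indicator_of_mem (hx i trivial) _).symm
    · obtain ⟨i, hi⟩ : ∃ i, x i ∉ s i := by simpa [Set.mem_pi] using hx
      rw [Set.indicator_of_notMem hx, Finset.prod_eq_zero (Finset.mem_univ i)]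
      exact Set.indicator_of_notMem hi _
  have hm : ∀ i, Measurable ((s i).indicator (f i)) := fun i => (hf i).indicator (hs i)
  rw [hind, lintegral_prod_eq_prod_lintegral_of_indepFun Finset.univ
    (fun i (x : ∀ i, X i) => (s i).indicator (f i) (x i))
    (iIndepFun_pi fun i => (hm i).aemeasurable) (fun i => (hm i).comp (measurable_pi_apply i))]
  refine Finset.prod_congr rfl fun i _ => ?_
  rw [withDensity_apply _ (hs i), ← lintegral_indicator (hs i)]
  exact (measurePreserving_eval μ i).lintegral_comp (hm i)

theorem exp_integral_sub_le_integral_exp_neg_withDensity {Ω : Type*} [MeasurableSpace Ω]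
    {Q : Measure Ω} [IsProbabilityMeasure Q] {l F G : Ω → ℝ} (hl : Measurable l)
    (hFG : ∀ x, F x ≤ G x) (hX : Integrable (fun x => l x - G x) Q)
    (hF : Integrable (fun x => Real.exp (-F x))
      (Q.withDensity fun x => ENNReal.ofReal (Real.exp (l x)))) :
    Real.exp (∫ x, (l x - G x) ∂Q) ≤
      ∫ x, Real.exp (-F x) ∂(Q.withDensity fun x => ENNReal.ofReal (Real.exp (l x))) := by
  have hm : Measurable fun x => ENNReal.ofReal (Real.exp (l x)) := by fun_prop
  have hfin : ∀ᵐ x ∂Q, ENNReal.ofReal (Real.exp (l x)) < ⊤ := .of_forall fun x => by simp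
  rw [integrable_withDensity_iff_integrable_smul' hm hfin] at hF
  rw [integral_withDensity_eq_integral_toReal_smul hm hfin]
  simp only [ENNReal.toReal_ofReal (Real.exp_pos _).le, smul_eq_mul, ← Real.exp_add] at hF ⊢
  set a := ∫ x, (l x - G x) ∂Q with ha
  have hlin : ∫ x, Real.exp a * ((l x - G x) + (1 - a)) ∂Q = Real.exp a := by
    rw [integral_const_mul, integral_add hX (integrable_const _), ← ha]
    simp
  rw [← hlin]
  refine integral_mono ((hX.add (integrable_const _)).const_mul _) hF fun x => ?_
  calc Real.exp a * ((l x - G x) + (1 - a))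
      ≤ Real.exp a * Real.exp ((l x - G x) - a) := by
        gcongr
        linarith [Real.add_one_le_exp ((l x - G x) - a)]
    _ = Real.exp (l x - G x) := by rw [← Real.exp_add]; ring_nf
    _ ≤ Real.exp (l x + -F x) := by gcongr; linarith [hFG x]

end MeasureTheory

namespace ProbabilityTheory

open scoped NNReal

/-- The logarithm of the density of `gaussianReal 0 v` with respect to `gaussianReal μ w`. -/
noncomputable def gaussianLogRatio (μ : ℝ) (w v : ℝ≥0) (x : ℝ) : ℝ :=
  (Real.log w - Real.log v) / 2 + (x - μ) ^ 2 / (2 * w) - x ^ 2 / (2 * v)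

@[fun_prop]
theorem measurable_gaussianLogRatio (μ : ℝ) (w v : ℝ≥0) :
    Measurable (gaussianLogRatio μ w v) := by
  unfold gaussianLogRatio
  fun_prop

theorem gaussianReal_eq_withDensity_gaussianLogRatio (μ : ℝ) {w v : ℝ≥0} (hw : w ≠ 0)
    (hv : v ≠ 0) :
    gaussianReal 0 v = (gaussianReal μ w).withDensity
      (fun x => ENNReal.ofReal (Real.exp (gaussianLogRatio μ w v x))) := by
  rw [gaussianReal_of_var_ne_zero _ hw, gaussianReal_of_var_ne_zero _ hv,
    ← withDensity_mul _ (measurable_gaussianPDF _ _) (by fun_prop)]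
  congr 1
  ext x
  have hw' : (0 : ℝ) < w := by positivity
  have hv' : (0 : ℝ) < v := by positivity
  have hsqrt : ∀ {u : ℝ}, 0 < u →
      (√(2 * Real.pi * u))⁻¹ = (√(2 * Real.pi))⁻¹ * Real.exp (-(Real.log u / 2)) := by
    intro u hu
    rw [Real.sqrt_mul (by positivity), mul_inv, Real.exp_neg, ← Real.log_sqrt hu.le,
      Real.exp_log (by positivity)]
  rw [Pi.mul_apply, gaussianPDF, gaussianPDF, ← ENNReal.ofReal_mul (gaussianPDFReal_nonneg _ _ _),
    gaussianPDFReal, gaussianPDFReal, hsqrt hw', hsqrt hv', mul_assoc, mul_assoc, mul_assoc,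
    ← Real.exp_add, ← Real.exp_add, ← Real.exp_add, gaussianLogRatio]
  ring_nf

theorem integrable_sq_gaussianReal (μ : ℝ) (w : ℝ≥0) :
    Integrable (fun x => x ^ 2) (gaussianReal μ w) :=
  (memLp_id_gaussianReal (μ := μ) (v := w) 2).integrable_sq

theorem integral_sq_gaussianReal (μ : ℝ) (w : ℝ≥0) :
    ∫ x, x ^ 2 ∂gaussianReal μ w = w + μ ^ 2 := by
  have h := variance_eq_sub (memLp_id_gaussianReal (μ := μ) (v := w) 2)
  rw [variance_id_gaussianReal] at h
  simp only [Pi.pow_apply, id_eq, integral_id_gaussianReal] at h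
  linarith

theorem integrable_sub_sq_gaussianReal (μ : ℝ) (w : ℝ≥0) :
    Integrable (fun x => (x - μ) ^ 2) (gaussianReal μ w) :=
  ((memLp_id_gaussianReal (μ := μ) (v := w) 2).sub (memLp_const μ)).integrable_sq

theorem integral_sub_sq_gaussianReal (μ : ℝ) (w : ℝ≥0) :
    ∫ x, (x - μ) ^ 2 ∂gaussianReal μ w = w := by
  have h := variance_eq_integral (aemeasurable_id (μ := gaussianReal μ w))
  rw [variance_id_gaussianReal] at h
  simpa [integral_id_gaussianReal] using h.symm

theorem integrable_gaussianLogRatio (μ : ℝ) (w v : ℝ≥0) :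
    Integrable (gaussianLogRatio μ w v) (gaussianReal μ w) :=
  ((integrable_const _).add ((integrable_sub_sq_gaussianReal μ w).div_const _)).sub
    ((integrable_sq_gaussianReal μ w).div_const _)

theorem integral_gaussianLogRatio (μ : ℝ) {w : ℝ≥0} (hw : w ≠ 0) (v : ℝ≥0) :
    ∫ x, gaussianLogRatio μ w v x ∂gaussianReal μ w =
      (Real.log w - Real.log v) / 2 + 1 / 2 - (w + μ ^ 2) / (2 * v) := by
  have h1 := (integrable_sub_sq_gaussianReal μ w).div_const (2 * w)
  have h2 := (integrable_sq_gaussianReal μ w).div_const (2 * v)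
  have hw' : (w : ℝ) ≠ 0 := by exact_mod_cast hw
  simp only [gaussianLogRatio]
  rw [integral_sub (by fun_prop) h2, integral_add (integrable_const _) h1,
    integral_div _ (fun x => (x - μ) ^ 2), integral_div _ (fun x => x ^ 2),
    integral_sub_sq_gaussianReal, integral_sq_gaussianReal, integral_const]
  simp
  field_simp

section Pi

variable {ι : Type*} [Fintype ι] (μ : ι → ℝ) (w : ℝ≥0) (a : ι → ℝ)

theorem pi_gaussianReal_eq_withDensity {w v : ℝ≥0} (hw : w ≠ 0) (hv : v ≠ 0) :
    Measure.pi (fun _ : ι => gaussianReal 0 v) =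
      (Measure.pi fun i => gaussianReal (μ i) w).withDensity
        (fun θ => ENNReal.ofReal (Real.exp (∑ i, gaussianLogRatio (μ i) w v (θ i)))) := by
  have h := fun i => gaussianReal_eq_withDensity_gaussianLogRatio (μ i) hw hv
  have : ∀ i, SigmaFinite ((gaussianReal (μ i) w).withDensity
      (fun x => ENNReal.ofReal (Real.exp (gaussianLogRatio (μ i) w v x)))) := fun i => by
    rw [← h i]; infer_instance
  rw [show (fun _ : ι => gaussianReal 0 v) = _ from funext h,
    Measure.pi_withDensity _ (fun i => by fun_prop)]
  congr 1
  ext θ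
  rw [Real.exp_sum, ENNReal.ofReal_prod_of_nonneg fun i _ => (Real.exp_pos _).le]

theorem memLp_linear_pi_gaussianReal :
    MemLp (fun θ : ι → ℝ => ∑ i, a i * (θ i - μ i)) 2
      (Measure.pi fun i => gaussianReal (μ i) w) := by
  refine memLp_finsetSum _ fun i _ => ?_
  have h := ((memLp_id_gaussianReal (μ := μ i) (v := w) 2).sub (memLp_const (μ i))).const_mul (a i)
  exact h.comp_measurePreserving (measurePreserving_eval (fun i => gaussianReal (μ i) w) i)

theorem integral_linear_pi_gaussianReal :
    ∫ θ : ι → ℝ, ∑ i, a i * (θ i - μ i) ∂(Measure.pi fun i => gaussianReal (μ i) w) = 0 := by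
  have hid : ∀ i, Integrable (fun x : ℝ => x) (gaussianReal (μ i) w) := fun i =>
    (memLp_id_gaussianReal (μ := μ i) (v := w) 1).integrable le_rfl
  have h : ∀ i, Integrable (fun x : ℝ => a i * (x - μ i)) (gaussianReal (μ i) w) := fun i =>
    ((hid i).sub (integrable_const _)).const_mul _
  rw [integral_finsetSum _ fun i _ => integrable_comp_eval (X := fun _ => ℝ)
    (f := fun x => a i * (x - μ i)) (h i)]
  refine Finset.sum_eq_zero fun i _ => ?_
  rw [integral_comp_eval (μ := fun i => gaussianReal (μ i) w) (f := fun x => a i * (x - μ i))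
    (h i).aestronglyMeasurable, integral_const_mul, integral_sub (hid i) (integrable_const _)]
  simp [integral_id_gaussianReal]

theorem integral_linear_sq_pi_gaussianReal :
    ∫ θ : ι → ℝ, (∑ i, a i * (θ i - μ i)) ^ 2 ∂(Measure.pi fun i => gaussianReal (μ i) w) =
      w * ∑ i, a i ^ 2 := by
  have h := memLp_linear_pi_gaussianReal μ w a
  rw [← variance_of_integral_eq_zero h.aestronglyMeasurable.aemeasurable
    (integral_linear_pi_gaussianReal μ w a)]
  have hsum := variance_sum_pi (μ := fun i => gaussianReal (μ i) w)
    (X := fun i x => a i * (x - μ i)) fun i =>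
      ((memLp_id_gaussianReal (μ := μ i) (v := w) 2).sub (memLp_const (μ i))).const_mul (a i)
  rw [Finset.sum_fn] at hsum
  rw [hsum, Finset.mul_sum]
  refine Finset.sum_congr rfl fun i _ => ?_
  rw [variance_const_mul, variance_sub_const (by fun_prop), variance_fun_id_gaussianReal, mul_comm]

end Pi

end ProbabilityTheory

/-- A function whose second derivative is at most `c` lies below its second-order Taylor model. -/
theorem le_quadratic_of_hasDerivAt_of_le {f f' f'' : ℝ → ℝ} {c : ℝ}
    (hf : ∀ z, HasDerivAt f (f' z) z) (hf' : ∀ z, HasDerivAt f' (f'' z) z) (hc : ∀ z, f'' z ≤ c)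
    (x y : ℝ) : f y ≤ f x + f' x * (y - x) + c / 2 * (y - x) ^ 2 := by
  set g : ℝ → ℝ := fun z => f x + f' x * (z - x) + c / 2 * (z - x) ^ 2 - f z with hg
  have hg' : ∀ z, HasDerivAt g (f' x + c * (z - x) - f' z) z := fun z => by
    have h := (hasDerivAt_id z).sub_const x
    convert! (((h.const_mul (f' x)).const_add (f x)).add ((h.pow 2).const_mul (c / 2))).sub (hf z)
      using 1
    simp
    ring
  have hd : deriv g = fun z => f' x + c * (z - x) - f' z := funext fun z => (hg' z).deriv
  have hd' : ∀ z, HasDerivAt (deriv g) (c - f'' z) z := fun z => by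
    rw [hd]
    convert! ((((hasDerivAt_id z).sub_const x).const_mul c).const_add (f' x)).sub (hf' z) using 1
    simp
  have hconv : ConvexOn ℝ Set.univ g :=
    convexOn_univ_of_deriv2_nonneg (fun z => (hg' z).differentiableAt)
      (fun z => (hd' z).differentiableAt) fun z => by
        simpa [(hd' z).deriv] using hc z
  have hmin : g x ≤ g y := by
    have hx := hg' x
    rcases lt_trichotomy x y with h | h | h
    · have := hconv.le_slope_of_hasDerivAt trivial trivial h hx
      rw [slope_def_field, le_div_iff₀ (sub_pos.2 h)] at this
      linarith
    · rw [h]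
    · have := hconv.slope_le_of_hasDerivAt trivial trivial h hx
      rw [slope_def_field, div_le_iff₀ (sub_pos.2 h)] at this
      linarith
  simp only [hg] at hmin
  linarith

/-- Bound on the negative log marginal likelihood under a centred Gaussian prior, obtained from the
Gaussian variational family centred at a comparison point `μ`. -/
theorem neg_log_integral_exp_neg_pi_gaussianReal_le {ι τ : Type*} [Fintype ι] [Nonempty ι]
    [Fintype τ] {v : NNReal} (hv : v ≠ 0) {c : ℝ} (hc : 0 ≤ c) {a : τ → ι → ℝ}
    (ha : ∀ t, ∑ i, a t i ^ 2 ≤ 1) {f f' f'' : τ → ℝ → ℝ} (hf0 : ∀ t z, 0 ≤ f t z)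
    (hf : ∀ t z, HasDerivAt (f t) (f' t z) z) (hf' : ∀ t z, HasDerivAt (f' t) (f'' t z) z)
    (hfc : ∀ t z, f'' t z ≤ c) (μ : ι → ℝ) :
    -Real.log (∫ θ : ι → ℝ, Real.exp (-∑ t, f t (∑ i, a t i * θ i))
        ∂(Measure.pi fun _ => gaussianReal 0 v)) ≤
      ∑ t, f t (∑ i, a t i * μ i) + (∑ i, μ i ^ 2) / (2 * v) +
        (Fintype.card ι : ℝ) / 2 *
          Real.log (1 + Fintype.card τ * c * v / Fintype.card ι) := by
  set m : ℝ := (Fintype.card ι : ℝ) with hm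
  set T : ℝ := (Fintype.card τ : ℝ) with hT
  have hm0 : 0 < m := by simpa [hm] using Fintype.card_pos
  have hT0 : 0 ≤ T := Nat.cast_nonneg _
  have hv0 : (0 : ℝ) < v := by positivity
  set r : ℝ := 1 + T * c * v / m with hr
  have hr0 : 0 < r := by positivity
  let w : NNReal := ⟨v / r, by positivity⟩
  have hwr : (w : ℝ) = v / r := rfl
  have hw0 : (0 : ℝ) < w := by rw [hwr]; positivity
  have hw : w ≠ 0 := by exact_mod_cast hw0.ne'
  let Q : Measure (ι → ℝ) := Measure.pi fun i => gaussianReal (μ i) w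
  let Y : τ → (ι → ℝ) → ℝ := fun t θ => ∑ i, a t i * (θ i - μ i)
  let l : (ι → ℝ) → ℝ := fun θ => ∑ i, gaussianLogRatio (μ i) w v (θ i)
  let z : τ → ℝ := fun t => ∑ i, a t i * μ i
  let G : (ι → ℝ) → ℝ := fun θ =>
    ∑ t, (f t (z t) + f' t (z t) * Y t θ + c / 2 * Y t θ ^ 2)
  have hYLp : ∀ t, MemLp (Y t) 2 Q := fun t => memLp_linear_pi_gaussianReal μ w (a t)
  have hY : ∀ t, Integrable (Y t) Q := fun t => (hYLp t).integrable (by norm_num)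
  have hY2 : ∀ t, Integrable (fun θ => Y t θ ^ 2) Q := fun t => (hYLp t).integrable_sq
  have hlin : ∀ t, Integrable (fun θ => f t (z t) + f' t (z t) * Y t θ) Q := fun t =>
    (integrable_const _).add ((hY t).const_mul _)
  have hterm : ∀ t, Integrable
      (fun θ => f t (z t) + f' t (z t) * Y t θ + c / 2 * Y t θ ^ 2) Q := fun t =>
    (hlin t).add ((hY2 t).const_mul _)
  have hGint : Integrable G Q := integrable_finsetSum _ fun t _ => hterm t
  have hli : ∀ i, Integrable (fun θ : ι → ℝ => gaussianLogRatio (μ i) w v (θ i)) Q := fun i =>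
    integrable_comp_eval (μ := fun i => gaussianReal (μ i) w)
      (integrable_gaussianLogRatio (μ i) w v)
  have hlint : Integrable l Q := integrable_finsetSum _ fun i _ => hli i
  have hl : ∫ θ, l θ ∂Q = m * ((Real.log w - Real.log v) / 2 + 1 / 2 - w / (2 * v)) -
      (∑ i, μ i ^ 2) / (2 * v) := by
    rw [integral_finsetSum _ fun i _ => hli i, Finset.sum_div]
    have h : ∀ i, ∫ θ : ι → ℝ, gaussianLogRatio (μ i) w v (θ i) ∂Q =
        ((Real.log w - Real.log v) / 2 + 1 / 2 - w / (2 * v)) - μ i ^ 2 / (2 * v) := fun i => by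
      rw [integral_comp_eval (μ := fun i => gaussianReal (μ i) w)
        (integrable_gaussianLogRatio (μ i) w v).aestronglyMeasurable,
        integral_gaussianLogRatio _ hw]
      ring
    simp_rw [h]
    rw [Finset.sum_sub_distrib, Finset.sum_const, nsmul_eq_mul, Finset.card_univ]
  have hG : ∫ θ, G θ ∂Q ≤ ∑ t, f t (z t) + T * (c / 2 * w) := by
    rw [integral_finsetSum _ fun t _ => hterm t]
    have h : ∀ t, ∫ θ, f t (z t) + f' t (z t) * Y t θ + c / 2 * Y t θ ^ 2 ∂Q ≤
        f t (z t) + c / 2 * w := fun t => by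
      rw [integral_add (hlin t) ((hY2 t).const_mul _),
        integral_add (integrable_const _) ((hY t).const_mul _), integral_const_mul,
        integral_const_mul, integral_linear_pi_gaussianReal, integral_linear_sq_pi_gaussianReal]
      simp only [integral_const, probReal_univ, one_smul, mul_zero, add_zero]
      gcongr
      exact mul_le_of_le_one_right hw0.le (ha t)
    refine (Finset.sum_le_sum fun t _ => h t).trans_eq ?_
    rw [Finset.sum_add_distrib, Finset.sum_const, nsmul_eq_mul, Finset.card_univ]
  have hFG : ∀ θ : ι → ℝ, ∑ t, f t (∑ i, a t i * θ i) ≤ G θ := fun θ =>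
    Finset.sum_le_sum fun t _ => by
      have hYt : Y t θ = ∑ i, a t i * θ i - z t := by
        simp only [Y, z, mul_sub, Finset.sum_sub_distrib]
      rw [hYt]
      exact le_quadratic_of_hasDerivAt_of_le (hf t) (hf' t) (hfc t) _ _
  have hcont : ∀ t, Continuous (f t) := fun t =>
    continuous_iff_continuousAt.2 fun x => (hf t x).continuousAt
  have hF : Integrable (fun θ : ι → ℝ => Real.exp (-∑ t, f t (∑ i, a t i * θ i)))
      (Measure.pi fun _ => gaussianReal 0 v) := by
    refine Integrable.of_bound (Continuous.aestronglyMeasurable (by fun_prop)) 1 (.of_forall fun θ => ?_)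
    rw [Real.norm_eq_abs, Real.abs_exp, Real.exp_le_one_iff]
    exact neg_nonpos.2 (Finset.sum_nonneg fun t _ => hf0 t _)
  rw [pi_gaussianReal_eq_withDensity μ hw hv] at hF ⊢
  have key := exp_integral_sub_le_integral_exp_neg_withDensity (Q := Q) (l := l) (G := G)
    (by fun_prop) hFG (hlint.sub hGint) hF
  rw [integral_sub hlint hGint, hl] at key
  have hlog := (Real.le_log_iff_exp_le ((Real.exp_pos _).trans_le key)).2 key
  have hlogw : Real.log w = Real.log v - Real.log r := by
    rw [hwr, Real.log_div hv0.ne' hr0.ne']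
  have hbal : T * (c / 2 * w) + m * (w / (2 * v)) = m / 2 := by
    rw [hwr]
    have : m * r = m + T * c * v := by rw [hr]; field_simp
    field_simp
    linarith
  rw [hlogw] at hlog
  linarith

/-- Theorem 2 of Appendix D: regret bound of the online RFGP Bayesian prediction loss
against the best RKHS estimator. With a Gaussian prior `p = ⨂ᵢ N(0, s²)` on `ℝ^m`,
unit-norm features `φ_t` approximating a standardized kernel `k̄` (values bounded by 1)
to uniform error `ε`, and nonnegative `L`-Lipschitz losses `L_t` with `|L_t''| ≤ c`,
for every coefficient vector `α`, setting `C = s²·Σ|α|`, `θ* = s²·Σ α_{t'}·φ_{t'}` and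
`f̂*_t = s²·Σ_{t'} α_{t'}·k̄(t,t')`, one has
`−log ∫ exp(−Σ_t L_t(⟨φ_t,θ⟩)) dp(θ)
  ≤ Σ_t L_t(f̂*_t) + (1+ε)C²/(2s²) + (m/2)·log(1 + Tcs²/m) + εLTC`. -/
theorem orfgp_regret_bound {m T : ℕ} (hm : 0 < m) (hT : 0 < T)
    (s : ℝ) (hs : 0 < s) (c : ℝ) (hc : 0 ≤ c) (ε : ℝ) (hε : 0 ≤ ε) (L : ℝ) (hL : 0 ≤ L)
    (p : Measure (Fin m → ℝ))
    (hp : p = Measure.pi fun _ : Fin m => gaussianReal 0 (⟨s ^ 2, sq_nonneg _⟩ : NNReal))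
    (φ : Fin T → EuclideanSpace ℝ (Fin m)) (hφ : ∀ t, ‖φ t‖ ≤ 1)
    (kbar : Fin T → Fin T → ℝ)
    (hkapprox : ∀ t t', |⟪φ t, φ t'⟫ - kbar t t'| ≤ ε)
    (hkbdd : ∀ t t', |kbar t t'| ≤ 1)
    (Lt : Fin T → ℝ → ℝ) (hL0 : ∀ t z, 0 ≤ Lt t z)
    (hLlip : ∀ t, LipschitzWith (Real.toNNReal L) (Lt t))
    (Lt' Lt'' : Fin T → ℝ → ℝ)
    (hLt' : ∀ t z, HasDerivAt (Lt t) (Lt' t z) z)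
    (hLt'' : ∀ t z, HasDerivAt (Lt' t) (Lt'' t z) z)
    (hLc : ∀ t z, |Lt'' t z| ≤ c)
    (α : Fin T → ℝ) (C : ℝ) (hC : C = s ^ 2 * ∑ t' : Fin T, |α t'|)
    (θstar : EuclideanSpace ℝ (Fin m))
    (hθstar : θstar = s ^ 2 • ∑ t' : Fin T, α t' • φ t')
    (fstar : Fin T → ℝ) (hfstar : ∀ t, fstar t = s ^ 2 * ∑ t' : Fin T, α t' * kbar t t') :
    -Real.log (∫ θ, Real.exp (-∑ t : Fin T, Lt t (∑ i, φ t i * θ i)) ∂p)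
      ≤ (∑ t : Fin T, Lt t (fstar t))
        + (1 + ε) * C ^ 2 / (2 * s ^ 2)
        + (m / 2 : ℝ) * Real.log (1 + T * c * s ^ 2 / m)
        + ε * L * T * C := by
  obtain ⟨v, hvs, rfl⟩ : ∃ v : NNReal, (v : ℝ) = s ^ 2 ∧
      p = Measure.pi fun _ : Fin m => gaussianReal 0 v := ⟨_, rfl, hp⟩
  have hs2 : (0 : ℝ) < s ^ 2 := by positivity
  have : Nonempty (Fin m) := ⟨⟨0, hm⟩⟩
  have hv : v ≠ 0 := fun h => hs2.ne' (by rw [← hvs, h, NNReal.coe_zero])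
  have hC0 : 0 ≤ C := by rw [hC]; positivity
  have hnorm : ∀ x : EuclideanSpace ℝ (Fin m), ∑ i, x i ^ 2 = ‖x‖ ^ 2 := fun x => by
    simp [EuclideanSpace.norm_sq_eq]
  have hlik := neg_log_integral_exp_neg_pi_gaussianReal_le hv hc (a := fun t i => φ t i)
    (fun t => by rw [hnorm]; exact pow_le_one₀ (norm_nonneg _) (hφ t)) hL0 hLt' hLt''
    (fun t z => (le_abs_self _).trans (hLc t z)) (fun i => θstar i)
  simp only [Fintype.card_fin, hvs, hnorm] at hlik
  have hθ : ‖θstar‖ ≤ C := by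
    rw [hθstar, hC, norm_smul, Real.norm_of_nonneg hs2.le]
    gcongr
    refine (norm_sum_le _ _).trans (Finset.sum_le_sum fun t _ => ?_)
    rw [norm_smul, Real.norm_eq_abs]
    exact mul_le_of_le_one_right (abs_nonneg _) (hφ t)
  have hθsq : ‖θstar‖ ^ 2 / (2 * s ^ 2) ≤ (1 + ε) * C ^ 2 / (2 * s ^ 2) := by
    gcongr
    calc ‖θstar‖ ^ 2 ≤ C ^ 2 := by gcongr
      _ ≤ (1 + ε) * C ^ 2 := le_mul_of_one_le_left (sq_nonneg C) (by linarith)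
  have hpred : ∀ t, |∑ i, φ t i * θstar i - fstar t| ≤ ε * C := fun t => by
    have hin : ∑ i, φ t i * θstar i = s ^ 2 * ∑ t', α t' * ⟪φ t, φ t'⟫ := by
      have h : ∑ i, φ t i * θstar i = ⟪φ t, θstar⟫ := by
        simp [PiLp.inner_apply, mul_comm]
      rw [h, hθstar, inner_smul_right, inner_sum]
      simp only [inner_smul_right]
    rw [hin, hfstar, ← mul_sub, ← Finset.sum_sub_distrib, abs_mul, abs_of_pos hs2, hC,
      mul_left_comm, Finset.mul_sum]
    gcongr
    refine (Finset.abs_sum_le_sum_abs _ _).trans (Finset.sum_le_sum fun t' _ => ?_)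
    rw [← mul_sub, abs_mul, mul_comm]
    gcongr
    exact hkapprox t t'
  have hloss : ∑ t, Lt t (∑ i, φ t i * θstar i) ≤ ∑ t, Lt t (fstar t) + ε * L * T * C := by
    have h : ∀ t, Lt t (∑ i, φ t i * θstar i) ≤ Lt t (fstar t) + L * (ε * C) := fun t => by
      have hlip := (hLlip t).dist_le_mul (∑ i, φ t i * θstar i) (fstar t)
      rw [Real.dist_eq, Real.dist_eq, Real.coe_toNNReal _ hL] at hlip
      linarith [le_abs_self (Lt t (∑ i, φ t i * θstar i) - Lt t (fstar t)),
        mul_le_mul_of_nonneg_left (hpred t) hL]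
    refine (Finset.sum_le_sum fun t _ => h t).trans_eq ?_
    rw [Finset.sum_add_distrib, Finset.sum_const, nsmul_eq_mul, Finset.card_univ, Fintype.card_fin]
    ring
  linarith
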